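/- arXiv:2407.16195 — 2 statements merged into one kernel-verified Lean document; each statement's English description precedes it below -/
import Mathlib

section
/- Let T > 0, s ∈ (1,2) and p ∈ G_s[0,T]. Then for every t ∈ [0,T] the series (L_1 p)(t) = Σ_{k≥0} g_k'(L) p^{(2k)}(t) converges, the function y_2 = −L_1 p is infinitely differentiable on [0,T] with y_2^{(n)}(t) = −Σ_{k≥0} g_k'(L) p^{(2k+n)}(t) for every integer n ≥ 0, and y_2 ∈ G_s[0,T], i.e., there exists C > 0 such that sup_{t∈[0,T]} |y_2^{(n)}(t)| ≤ C^{n+1} (n!)^s for all integers n ≥ 0. -/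
open Set Filter intervalIntegral

/-- The generating functions `g_k` of the beam model, defined by iterated integrals. -/
noncomputable def genG (ρ EI : ℝ → ℝ) (m : ℝ) : ℕ → ℝ → ℝ
  | 0 => fun _ => 1
  | 1 => fun x =>
      -(∫ s₁ in (0:ℝ)..x, ∫ s₂ in (0:ℝ)..s₁, ∫ s₃ in (0:ℝ)..s₂, ∫ s₄ in (0:ℝ)..s₃,
          ρ s₄ / EI s₂)
      - m * ∫ s₁ in (0:ℝ)..x, ∫ s₂ in (0:ℝ)..s₁, ∫ _s₃ in (0:ℝ)..s₂, 1 / EI s₂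
  | (k + 2) => fun x =>
      -(∫ s₁ in (0:ℝ)..x, ∫ s₂ in (0:ℝ)..s₁, ∫ s₃ in (0:ℝ)..s₂, ∫ s₄ in (0:ℝ)..s₃,
          ρ s₄ * genG ρ EI m (k + 1) s₄ / EI s₂)

/-- The generating functions `h_k` of the beam model, defined by iterated integrals. -/
noncomputable def genH (ρ EI : ℝ → ℝ) (J : ℝ) : ℕ → ℝ → ℝ
  | 0 => fun x => x
  | 1 => fun x =>
      -(∫ s₁ in (0:ℝ)..x, ∫ s₂ in (0:ℝ)..s₁, ∫ s₃ in (0:ℝ)..s₂, ∫ s₄ in (0:ℝ)..s₃,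
          s₄ * ρ s₄ / EI s₂)
      + J * ∫ s₁ in (0:ℝ)..x, ∫ s₂ in (0:ℝ)..s₁, 1 / EI s₂
  | (k + 2) => fun x =>
      -(∫ s₁ in (0:ℝ)..x, ∫ s₂ in (0:ℝ)..s₁, ∫ s₃ in (0:ℝ)..s₂, ∫ s₄ in (0:ℝ)..s₃,
          ρ s₄ * genH ρ EI J (k + 1) s₄ / EI s₂)

/-- Membership in the Gevrey class `G_s[0,T]`: a smooth function whose derivatives satisfy
`sup_{t ∈ [0,T]} |y⁽ᵐ⁾(t)| ≤ D^(m+1) (m!)^s` for some `D > 0`. -/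
def MemGevrey (s T : ℝ) (y : ℝ → ℝ) : Prop :=
  ContDiff ℝ (⊤ : ℕ∞) y ∧ ∃ D > 0, ∀ (n : ℕ), ∀ t ∈ Set.Icc (0:ℝ) T,
    |iteratedDeriv n y t| ≤ D ^ (n + 1) * (n.factorial : ℝ) ^ s

lemma bm_prim_cont {L : ℝ} (hL : 0 < L) {f : ℝ → ℝ} (hf : ContinuousOn f (Icc 0 L)) :
    ContinuousOn (fun x => ∫ t in (0:ℝ)..x, f t) (Icc 0 L) := by
  have := intervalIntegral.continuousOn_primitive_interval (f := f) (a := 0) (b := L)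
    (μ := MeasureTheory.volume) (by
      rw [uIcc_of_le hL.le]
      exact hf.integrableOn_Icc)
  rwa [uIcc_of_le hL.le] at this

lemma bm_prim_bound {L : ℝ} {f : ℝ → ℝ} {C : ℝ} {n : ℕ}
    (hf : ∀ x ∈ Icc 0 L, |f x| ≤ C * (x ^ n / n.factorial)) :
    ∀ x ∈ Icc 0 L, |∫ t in (0:ℝ)..x, f t| ≤ C * (x ^ (n + 1) / (n + 1).factorial) := by
  intro x hx
  have h := intervalIntegral.norm_integral_le_of_norm_le (f := f)
    (g := fun t => C * (t ^ n / n.factorial)) (μ := MeasureTheory.volume) hx.1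
    (Eventually.of_forall fun t ht => hf t ⟨ht.1.le, ht.2.trans hx.2⟩)
    (by apply Continuous.intervalIntegrable; fun_prop)
  rw [Real.norm_eq_abs] at h
  refine h.trans (le_of_eq ?_)
  rw [intervalIntegral.integral_const_mul, intervalIntegral.integral_div, integral_pow,
    Nat.factorial_succ]
  have : (n.factorial : ℝ) ≠ 0 := by positivity
  push_cast
  field_simp
  simp

lemma bm_deriv {L : ℝ} (hL : 0 < L) {f g : ℝ → ℝ} (hf : ContinuousOn f (Icc 0 L)) {c : ℝ}
    (hg : ∀ x ∈ Icc 0 L, g x = c + ∫ t in (0:ℝ)..x, f t) :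
    ∀ x ∈ Icc 0 L, HasDerivWithinAt g (f x) (Icc 0 L) x := by
  intro x hx
  have : Fact (x ∈ Icc 0 L) := ⟨hx⟩
  have h1 : IntervalIntegrable f MeasureTheory.volume 0 x := by
    apply ContinuousOn.intervalIntegrable
    rw [uIcc_of_le hx.1]
    exact hf.mono (Icc_subset_Icc le_rfl hx.2)
  have h2 := intervalIntegral.integral_hasDerivWithinAt_right h1 (s := Icc 0 L) (t := Icc 0 L)
    (hf.stronglyMeasurableAtFilter_nhdsWithin measurableSet_Icc x) (hf x hx)
  exact (h2.const_add c).congr hg (hg x hx)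

/-- core of the iterated integral: inner three integrals. -/
lemma bm_core {L R c : ℝ} (hL : 0 < L) (hc : 0 < c) {F EI : ℝ → ℝ}
    (hEI : ContinuousOn EI (Icc 0 L)) (hEIc : ∀ x ∈ Icc (0:ℝ) L, c ≤ EI x)
    (hF : ContinuousOn F (Icc 0 L)) {n : ℕ}
    (hFb : ∀ x ∈ Icc 0 L, |F x| ≤ R * (x ^ n / n.factorial)) :
    ContinuousOn (fun s₁ => ∫ s₂ in (0:ℝ)..s₁, ∫ s₃ in (0:ℝ)..s₂, ∫ s₄ in (0:ℝ)..s₃,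
      F s₄ / EI s₂) (Icc 0 L) ∧
    ∀ x ∈ Icc 0 L, |∫ s₂ in (0:ℝ)..x, ∫ s₃ in (0:ℝ)..s₂, ∫ s₄ in (0:ℝ)..s₃, F s₄ / EI s₂|
      ≤ (R / c) * (x ^ (n + 3) / (n + 3).factorial) := by
  simp only [intervalIntegral.integral_div]
  have hne : ∀ x ∈ Icc (0:ℝ) L, EI x ≠ 0 := fun x hx => (hc.trans_le (hEIc x hx)).ne'
  refine ⟨bm_prim_cont hL ((bm_prim_cont hL (bm_prim_cont hL hF)).div hEI hne), ?_⟩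
  apply bm_prim_bound
  intro x hx
  have h := bm_prim_bound (bm_prim_bound hFb) x hx
  rw [abs_div, abs_of_pos (hc.trans_le (hEIc x hx)), div_mul_eq_mul_div]
  exact div_le_div₀ ((abs_nonneg _).trans h) h hc (hEIc x hx)

lemma bm_core2 {L c : ℝ} (hL : 0 < L) (hc : 0 < c) {EI : ℝ → ℝ}
    (hEI : ContinuousOn EI (Icc 0 L)) (hEIc : ∀ x ∈ Icc (0:ℝ) L, c ≤ EI x) :
    ContinuousOn (fun s₁ => ∫ s₂ in (0:ℝ)..s₁, ∫ _s₃ in (0:ℝ)..s₂, 1 / EI s₂) (Icc 0 L) ∧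
    ∀ x ∈ Icc 0 L, |∫ s₂ in (0:ℝ)..x, ∫ _s₃ in (0:ℝ)..s₂, 1 / EI s₂|
      ≤ (1 / c) * (x ^ 2 / (2).factorial) := by
  have hne : ∀ x ∈ Icc (0:ℝ) L, EI x ≠ 0 := fun x hx => (hc.trans_le (hEIc x hx)).ne'
  have e : ∀ s, ∫ _s₃ in (0:ℝ)..s, 1 / EI s = s / EI s := by
    intro s; simp [div_eq_mul_inv]
  simp only [e]
  refine ⟨bm_prim_cont hL (continuousOn_id.div hEI hne), ?_⟩
  apply bm_prim_bound
  intro x hx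
  rw [abs_div, abs_of_pos (hc.trans_le (hEIc x hx)), abs_of_nonneg hx.1]
  have := div_le_div₀ hx.1 le_rfl hc (hEIc x hx)
  simpa [div_eq_mul_inv, mul_comm] using this

lemma bm_gen {L m R c : ℝ} (hL : 0 < L) (hm : 0 < m) (hc : 0 < c) (hR : 0 < R) {ρ EI : ℝ → ℝ}
    (hρ : ContinuousOn ρ (Icc 0 L)) (hρb : ∀ x ∈ Icc (0:ℝ) L, |ρ x| ≤ R)
    (hEI : ContinuousOn EI (Icc 0 L)) (hEIc : ∀ x ∈ Icc (0:ℝ) L, c ≤ EI x) (k : ℕ) :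
    ∃ P : ℝ → ℝ, ContinuousOn P (Icc 0 L) ∧
      (∀ x ∈ Icc 0 L, |P x| ≤ ((R * L + m) / c * (R / c) ^ k) *
        (x ^ (4 * k + 2) / (4 * k + 2).factorial)) ∧
      ∀ x ∈ Icc 0 L, genG ρ EI m (k + 1) x = 0 + ∫ t in (0:ℝ)..x, P t := by
  induction k with
  | zero =>
    obtain ⟨c1, b1⟩ := bm_core (n := 0) (R := R) hL hc hEI hEIc hρ (by simpa using hρb)
    obtain ⟨c2, b2⟩ := bm_core2 hL hc hEI hEIc
    refine ⟨_, c1.neg.sub (c2.const_smul m), ?_, ?_⟩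
    · intro x hx
      have h1 := b1 x hx
      have h2 := b2 x hx
      simp only [Pi.sub_apply, Pi.neg_apply, Pi.smul_apply, smul_eq_mul]
      refine (abs_sub _ _).trans ?_
      rw [abs_neg, abs_mul, abs_of_pos hm]
      refine (add_le_add h1 (mul_le_mul_of_nonneg_left h2 hm.le)).trans ?_
      simp only [Nat.factorial]
      have : x ^ 3 ≤ L * x ^ 2 := by
        nlinarith [mul_le_mul_of_nonneg_right hx.2 (sq_nonneg x)]
      have h0 : 0 ≤ x ^ 2 := sq_nonneg x
      have hLx : 0 ≤ L * x ^ 2 := by positivity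
      norm_num
      field_simp
      nlinarith [mul_le_mul_of_nonneg_left this hR.le, mul_nonneg hR.le hLx]
    · intro x hx
      have hi : ∀ f : ℝ → ℝ, ContinuousOn f (Icc 0 L) →
          IntervalIntegrable f MeasureTheory.volume 0 x := fun f hf => by
        apply ContinuousOn.intervalIntegrable
        rw [uIcc_of_le hx.1]
        exact hf.mono (Icc_subset_Icc le_rfl hx.2)
      have h := intervalIntegral.integral_sub (hi _ c1.neg) (hi _ (c2.const_smul m))
      simp only [Pi.neg_apply, Pi.smul_apply, intervalIntegral.integral_neg,
        intervalIntegral.integral_smul] at h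
      simp only [zero_add, genG, Pi.sub_apply, Pi.neg_apply, Pi.smul_apply]
      rw [h, smul_eq_mul]
  | succ k ih =>
    obtain ⟨P, hP, hPb, hPg⟩ := ih
    have hgc : ContinuousOn (genG ρ EI m (k + 1)) (Icc 0 L) :=
      (bm_prim_cont hL hP).congr (fun x hx => by rw [hPg x hx, zero_add])
    have hgb := bm_prim_bound hPb
    have hFb : ∀ x ∈ Icc 0 L, |ρ x * genG ρ EI m (k + 1) x| ≤
        (R * ((R * L + m) / c * (R / c) ^ k)) *
          (x ^ (4 * k + 2 + 1) / (4 * k + 2 + 1).factorial) := by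
      intro x hx
      rw [abs_mul, mul_assoc, hPg x hx, zero_add]
      exact mul_le_mul (hρb x hx) (hgb x hx) (abs_nonneg _) hR.le
    obtain ⟨c1, b1⟩ := bm_core hL hc hEI hEIc (hρ.mul hgc) hFb
    refine ⟨_, c1.neg, ?_, ?_⟩
    · intro x hx
      rw [Pi.neg_apply, abs_neg]
      refine (b1 x hx).trans (le_of_eq ?_)
      rw [show 4 * (k + 1) + 2 = 4 * k + 2 + 1 + 3 by ring]
      congr 1
      ring
    · intro x hx
      simp only [zero_add, genG, Pi.neg_apply, Pi.mul_apply, intervalIntegral.integral_neg]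

lemma bm_deriv_bound {L m : ℝ} (hL : 0 < L) (hm : 0 < m) {ρ EI : ℝ → ℝ}
    (hρ : ContinuousOn ρ (Icc 0 L)) (hEI : ContinuousOn EI (Icc 0 L))
    (hEIpos : ∃ c > 0, ∀ x ∈ Set.Icc (0:ℝ) L, c ≤ EI x) :
    ∃ B > 0, ∃ A > 0, ∀ k : ℕ, |derivWithin (genG ρ EI m (k + 1)) (Icc 0 L) L| ≤
      B * A ^ k / (4 * k + 2).factorial := by
  obtain ⟨c, hc, hEIc⟩ := hEIpos
  obtain ⟨R, hR⟩ := isCompact_Icc.exists_bound_of_continuousOn hρ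
  have hR0 : 0 < |R| + 1 := by positivity
  refine ⟨((|R| + 1) * L + m) / c * L ^ 2, by positivity, (|R| + 1) / c * L ^ 4, by positivity,
    fun k => ?_⟩
  obtain ⟨P, hP, hPb, hPg⟩ := bm_gen (R := |R| + 1) hL hm hc hR0 hρ
    (fun x hx => (hR x hx).trans (by linarith [le_abs_self R])) hEI hEIc k
  have hLm : L ∈ Icc 0 L := ⟨hL.le, le_rfl⟩
  rw [(bm_deriv hL hP hPg L hLm).derivWithin (uniqueDiffOn_Icc hL L hLm)]
  refine (hPb L hLm).trans (le_of_eq ?_)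
  rw [mul_pow, pow_add, pow_mul]
  ring

lemma bm_summable_aux {M ε : ℝ} (hM : 0 < M) (hε : 0 < ε) :
    Summable (fun k : ℕ => M ^ k / (k.factorial : ℝ) ^ ε) := by
  set N : ℝ := (2 * M) ^ (1 / ε) with hN
  have hN0 : 0 < N := by positivity
  have hNe : N ^ ε = 2 * M := by
    rw [hN, ← Real.rpow_mul (by positivity)]
    simp [hε.ne']
  refine Summable.of_nonneg_of_le (fun k => by positivity) (fun k => ?_)
    ((summable_geometric_of_lt_one (r := (1/2 : ℝ)) (by norm_num) (by norm_num)).mul_left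
      ((Real.exp N) ^ ε))
  have h1 : N ^ k / k.factorial ≤ Real.exp N := Real.pow_div_factorial_le_exp N hN0.le k
  have h2 := Real.rpow_le_rpow (by positivity) h1 hε.le
  rw [Real.div_rpow (by positivity) (by positivity), ← Real.rpow_natCast N k,
    ← Real.rpow_mul hN0.le, mul_comm (k : ℝ) ε, Real.rpow_mul hN0.le, hNe, Real.rpow_natCast,
    mul_pow] at h2
  calc M ^ k / (k.factorial : ℝ) ^ ε
      = (2 ^ k * M ^ k / (k.factorial : ℝ) ^ ε) * (1 / 2) ^ k := by
        rw [one_div, inv_pow]; field_simp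
    _ ≤ _ := by gcongr

lemma bm_summable {a : ℕ → ℝ} {A B E s : ℝ} (hA : 0 < A) (hB : 0 < B) (hE : 0 < E)
    (hs₁ : 1 < s) (hs₂ : s < 2)
    (ha : ∀ k, |a (k + 1)| ≤ B * A ^ k / (4 * k + 2).factorial) :
    Summable (fun k : ℕ => |a k| * (E ^ (2 * k) * ((2 * k).factorial : ℝ) ^ s)) := by
  rw [← summable_nat_add_iff 1]
  refine Summable.of_nonneg_of_le (fun k => by positivity) (fun k => ?_)
    ((bm_summable_aux (M := A * E ^ 2 * 16) (ε := 2 - s) (by positivity) (by linarith)).mul_left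
      (B * E ^ 2 * 16))
  set q : ℝ := ((2 * k + 1).factorial : ℝ) with hq
  have hq1 : 1 ≤ q := by
    rw [hq]; exact_mod_cast Nat.one_le_iff_ne_zero.mpr (Nat.factorial_ne_zero _)
  have hq0 : 0 < q := by linarith
  have hkq : (k.factorial : ℝ) ≤ q := by
    rw [hq]; exact_mod_cast Nat.factorial_le (by omega)
  have h1 : q ^ 2 ≤ ((4 * k + 2).factorial : ℝ) := by
    have := Nat.le_of_dvd (Nat.factorial_pos _)
      (Nat.factorial_mul_factorial_dvd_factorial_add (2 * k + 1) (2 * k + 1))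
    rw [show 2 * k + 1 + (2 * k + 1) = 4 * k + 2 by ring] at this
    rw [hq, sq]; exact_mod_cast this
  have h2 : ((2 * (k + 1)).factorial : ℝ) ^ s ≤ 16 ^ (k + 1) * q ^ s := by
    have e : ((2 * (k + 1)).factorial : ℝ) = (2 * (k + 1) : ℕ) * q := by
      rw [hq, show 2 * (k + 1) = 2 * k + 1 + 1 by ring, Nat.factorial_succ]; push_cast; ring
    have e2 : ((2 * (k + 1) : ℕ) : ℝ) ≤ 4 ^ (k + 1) := by
      have : 2 * (k + 1) < 2 ^ (2 * (k + 1)) := Nat.lt_two_pow_self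
      rw [pow_mul] at this
      exact_mod_cast this.le
    rw [e, Real.mul_rpow (by positivity) hq0.le]
    gcongr
    calc ((2 * (k + 1) : ℕ) : ℝ) ^ s ≤ ((4:ℝ) ^ (k + 1)) ^ s :=
          Real.rpow_le_rpow (by positivity) e2 (by linarith)
      _ ≤ ((4:ℝ) ^ (k + 1)) ^ (2:ℝ) :=
          Real.rpow_le_rpow_of_exponent_le (one_le_pow₀ (by norm_num)) hs₂.le
      _ = 16 ^ (k + 1) := by
          rw [Real.rpow_two, ← pow_mul, mul_comm, pow_mul]; norm_num
  have h3 : q ^ s = q ^ 2 / q ^ (2 - s) := by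
    rw [← Real.rpow_two, ← Real.rpow_sub hq0]; congr 1; ring
  have h4 : (k.factorial : ℝ) ^ (2 - s) ≤ q ^ (2 - s) :=
    Real.rpow_le_rpow (by positivity) hkq (by linarith)
  have h5 : |a (k + 1)| ≤ B * A ^ k / q ^ 2 := (ha k).trans (by gcongr)
  calc |a (k + 1)| * (E ^ (2 * (k + 1)) * ((2 * (k + 1)).factorial : ℝ) ^ s)
      ≤ (B * A ^ k / q ^ 2) * (E ^ (2 * (k + 1)) * (16 ^ (k + 1) * q ^ s)) := by gcongr
    _ = (B * E ^ 2 * 16) * ((A * E ^ 2 * 16) ^ k / q ^ (2 - s)) := by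
        rw [h3]
        have : q ^ (2 - s) ≠ 0 := by positivity
        field_simp
        ring
    _ ≤ _ := by gcongr

lemma bm_fact {s : ℝ} (hs₁ : 1 < s) (hs₂ : s < 2) (i n : ℕ) :
    ((i + n).factorial : ℝ) ^ s ≤ 4 ^ (i + n) * ((i.factorial : ℝ) ^ s * (n.factorial : ℝ) ^ s) := by
  have h : ((i + n).factorial : ℝ) ≤ 2 ^ (i + n) * (i.factorial * n.factorial) := by
    have h1 := Nat.add_choose_mul_factorial_mul_factorial i n
    have h2 : (i + n).choose n ≤ 2 ^ (i + n) := Nat.choose_le_two_pow _ _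
    rw [← h1, mul_assoc]
    push_cast
    gcongr
    exact_mod_cast h2
  refine (Real.rpow_le_rpow (by positivity) h (by linarith)).trans ?_
  rw [Real.mul_rpow (by positivity) (by positivity), Real.mul_rpow (by positivity) (by positivity)]
  gcongr
  refine (Real.rpow_le_rpow_of_exponent_le (one_le_pow₀ (by norm_num)) hs₂.le).trans ?_
  rw [Real.rpow_two, ← pow_mul, mul_comm, pow_mul]; norm_num

lemma bm_series {T : ℝ} (hT : 0 < T) {f : ℕ → ℕ → ℝ → ℝ} {u : ℕ → ℕ → ℝ}
    (hd : ∀ n k t, HasDerivAt (f n k) (f (n + 1) k t) t)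
    (hu : ∀ n, Summable (u n)) (hb : ∀ n k, ∀ t ∈ Icc 0 T, |f n k t| ≤ u n k) (n : ℕ) :
    ∀ t ∈ Icc 0 T, HasDerivWithinAt (fun t => ∑' k, f n k t) (∑' k, f (n + 1) k t) (Icc 0 T) t := by
  have hc : ∀ n k, Continuous (f n k) := fun n k =>
    continuous_iff_continuousAt.mpr fun t => (hd n k t).continuousAt
  have hsum : ∀ n, ∀ t ∈ Icc 0 T, Summable (fun k => f n k t) := fun n t ht =>
    Summable.of_norm_bounded (hu n) (fun k => hb n k t ht)
  have hcont : ContinuousOn (fun t => ∑' k, f (n + 1) k t) (Icc 0 T) :=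
    continuousOn_tsum (fun k => (hc _ k).continuousOn) (hu (n + 1)) (fun k t ht => hb _ k t ht)
  refine bm_deriv hT hcont (c := ∑' k, f n k 0) ?_
  intro t ht
  have h0 : (0:ℝ) ∈ Icc 0 T := ⟨le_rfl, hT.le⟩
  have hmem : ∀ x ∈ Set.uIoc 0 t, x ∈ Icc 0 T := by
    intro x hx
    rw [uIoc_of_le ht.1] at hx
    exact ⟨hx.1.le, hx.2.trans ht.2⟩
  have h := intervalIntegral.hasSum_integral_of_dominated_convergence
    (μ := MeasureTheory.volume) (a := 0) (b := t)
    (F := fun k => f (n + 1) k) (f := fun t => ∑' k, f (n + 1) k t)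
    (fun k _ => u (n + 1) k) (fun k => (hc _ k).aestronglyMeasurable)
    (fun k => Eventually.of_forall fun x hx => hb _ k x (hmem x hx))
    (Eventually.of_forall fun x _ => hu _)
    (by simp)
    (Eventually.of_forall fun x hx => (hsum _ x (hmem x hx)).hasSum)
  have e : ∀ k, ∫ x in (0:ℝ)..t, f (n + 1) k x = f n k t - f n k 0 := fun k =>
    intervalIntegral.integral_eq_sub_of_hasDerivAt (fun x _ => hd n k x)
      ((hc _ k).intervalIntegrable _ _)
  simp only [e] at h
  rw [← h.tsum_eq, (hsum n t ht).tsum_sub (hsum n 0 h0)]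
  ring

/-- for `p ∈ G_s[0,T]`, the series `(L₁ p)(t) = Σ_k g_k'(L) p⁽²ᵏ⁾(t)` converges
for every `t ∈ [0,T]`, `y₂ = -L₁ p` is infinitely differentiable on `[0,T]` with
`y₂⁽ⁿ⁾(t) = -Σ_k g_k'(L) p⁽²ᵏ⁺ⁿ⁾(t)`, and `y₂ ∈ G_s[0,T]`, i.e. there is `C > 0` with
`sup_{t∈[0,T]} |y₂⁽ⁿ⁾(t)| ≤ C^(n+1) (n!)^s` for all `n`. -/
theorem stmt11 (L m J : ℝ) (hL : 0 < L) (hm : 0 < m) (hJ : 0 < J)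
    (ρ EI : ℝ → ℝ)
    (hρ : ContDiffOn ℝ 4 ρ (Set.Icc 0 L)) (hEI : ContDiffOn ℝ 4 EI (Set.Icc 0 L))
    (hρpos : ∃ c > 0, ∀ x ∈ Set.Icc (0:ℝ) L, c ≤ ρ x)
    (hEIpos : ∃ c > 0, ∀ x ∈ Set.Icc (0:ℝ) L, c ≤ EI x)
    (T s : ℝ) (hT : 0 < T) (hs₁ : 1 < s) (hs₂ : s < 2)
    (p : ℝ → ℝ) (hp : MemGevrey s T p)
    (y₂ : ℝ → ℝ)
    (hy₂ : y₂ = fun t =>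
      -∑' k : ℕ, derivWithin (genG ρ EI m k) (Set.Icc 0 L) L * iteratedDeriv (2 * k) p t) :
    (∀ t ∈ Set.Icc (0:ℝ) T,
      Summable (fun k : ℕ =>
        derivWithin (genG ρ EI m k) (Set.Icc 0 L) L * iteratedDeriv (2 * k) p t)) ∧
    ContDiffOn ℝ (⊤ : ℕ∞) y₂ (Set.Icc 0 T) ∧
    (∀ (n : ℕ), ∀ t ∈ Set.Icc (0:ℝ) T,
      iteratedDerivWithin n y₂ (Set.Icc 0 T) t =
        -∑' k : ℕ, derivWithin (genG ρ EI m k) (Set.Icc 0 L) L *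
          iteratedDeriv (2 * k + n) p t) ∧
    (∃ C > 0, ∀ (n : ℕ), ∀ t ∈ Set.Icc (0:ℝ) T,
      |iteratedDerivWithin n y₂ (Set.Icc 0 T) t| ≤ C ^ (n + 1) * (n.factorial : ℝ) ^ s) := by
  obtain ⟨hpc, D, hD, hpD⟩ := hp
  obtain ⟨B, hB, A, hA, hbd⟩ := bm_deriv_bound hL hm hρ.continuousOn hEI.continuousOn hEIpos
  set a : ℕ → ℝ := fun k => derivWithin (genG ρ EI m k) (Set.Icc 0 L) L with ha
  have hW := bm_summable (a := a) (E := 4 * D) hA hB (by positivity) hs₁ hs₂ hbd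
  set w : ℕ → ℝ := fun k => |a k| * ((4 * D) ^ (2 * k) * ((2 * k).factorial : ℝ) ^ s) with hw
  have hw0 : ∀ k, 0 ≤ w k := fun k => by positivity
  set f : ℕ → ℕ → ℝ → ℝ := fun n k t => a k * iteratedDeriv (2 * k + n) p t with hf
  set u : ℕ → ℕ → ℝ := fun n k => (D * (4 * D) ^ n * (n.factorial : ℝ) ^ s) * w k with hu
  have husum : ∀ n, Summable (u n) := fun n => hW.mul_left _
  have hb : ∀ n k, ∀ t ∈ Icc 0 T, |f n k t| ≤ u n k := by
    intro n k t ht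
    have h1 := hpD (2 * k + n) t ht
    have h2 := bm_fact hs₁ hs₂ (2 * k) n
    calc |f n k t| = |a k| * |iteratedDeriv (2 * k + n) p t| := abs_mul _ _
      _ ≤ |a k| * (D ^ (2 * k + n + 1) * (4 ^ (2 * k + n) *
          (((2 * k).factorial : ℝ) ^ s * (n.factorial : ℝ) ^ s))) := by
        gcongr
        exact h1.trans (by gcongr)
      _ = u n k := by
        simp only [hu, hw]
        rw [mul_pow, mul_pow, pow_succ, pow_add, pow_add]
        ring
  have hd : ∀ n k t, HasDerivAt (f n k) (f (n + 1) k t) t := by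
    intro n k t
    have h1 : DifferentiableAt ℝ (iteratedDeriv (2 * k + n) p) t :=
      (hpc.differentiable_iteratedDeriv (2 * k + n)
        (WithTop.coe_lt_coe.mpr (ENat.natCast_lt_top _))) t
    have h2 := h1.hasDerivAt.const_mul (a k)
    rw [← iteratedDeriv_succ] at h2
    exact h2
  have hser := bm_series hT hd husum hb
  have hy0 : y₂ = fun t => -∑' k, f 0 k t := hy₂
  have hit : ∀ n : ℕ, ∀ t ∈ Icc (0:ℝ) T,
      iteratedDerivWithin n y₂ (Icc 0 T) t = -∑' k, f n k t := by
    intro n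
    induction n with
    | zero => intro t ht; rw [iteratedDerivWithin_zero, hy0]
    | succ n ih =>
      intro t ht
      rw [iteratedDerivWithin_succ, derivWithin_congr ih (ih t ht)]
      exact (hser n t ht).neg.derivWithin (uniqueDiffOn_Icc hT t ht)
  refine ⟨fun t ht => Summable.of_norm_bounded (husum 0) (fun k => hb 0 k t ht), ?_, hit, ?_⟩
  · apply contDiffOn_of_differentiableOn_deriv
    intro n _
    have : DifferentiableOn ℝ (fun t => -∑' k, f n k t) (Icc 0 T) := fun t ht =>
      (hser n t ht).neg.differentiableWithinAt
    exact this.congr (hit n)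
  · have hW0 : 0 ≤ ∑' k, w k := tsum_nonneg hw0
    refine ⟨(4 * D) * (∑' k, w k + 1), by positivity, fun n t ht => ?_⟩
    rw [hit n t ht, abs_neg]
    have h1 : |∑' k, f n k t| ≤ ∑' k, u n k :=
      tsum_of_norm_bounded (f := fun k => f n k t) (husum n).hasSum (fun k => hb n k t ht)
    refine h1.trans ?_
    rw [tsum_mul_left]
    have h2 : ∑' k, w k ≤ (∑' k, w k + 1) ^ (n + 1) :=
      (by linarith : ∑' k, w k ≤ ∑' k, w k + 1).trans
        (le_self_pow₀ (by linarith) (by omega))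
    calc D * (4 * D) ^ n * (n.factorial : ℝ) ^ s * ∑' k, w k
        ≤ (4 * D) * (4 * D) ^ n * (n.factorial : ℝ) ^ s * (∑' k, w k + 1) ^ (n + 1) := by
          gcongr
          linarith
      _ = (4 * D * (∑' k, w k + 1)) ^ (n + 1) * (n.factorial : ℝ) ^ s := by
          rw [mul_pow (4 * D)]; ring
end

section
/- Let T > 0, s ∈ (1,2) and p ∈ G_s[0,T], and set y_1 = L_2 p and y_2 = −L_1 p, where (L_1 q)(t) = Σ_{k≥0} g_k'(L) q^{(2k)}(t) and (L_2 q)(t) = Σ_{k≥0} h_k'(L) q^{(2k)}(t). Then y_1 and y_2 satisfy the infinite-order differential equation Σ_{k≥0} g_k'(L) y_1^{(2k)}(t) + Σ_{k≥0} h_k'(L) y_2^{(2k)}(t) = 0 for all t ∈ [0,T]. -/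
open Set Filter intervalIntegral

namespace Beam

/-- Integration from `0`. -/
noncomputable def Iop (f : ℝ → ℝ) (x : ℝ) : ℝ := ∫ s in (0:ℝ)..x, f s

lemma Iop_hasDerivAt {f : ℝ → ℝ} (hf : Continuous f) (x : ℝ) : HasDerivAt (Iop f) (f x) x :=
  intervalIntegral.integral_hasDerivAt_right (hf.intervalIntegrable _ _)
    (hf.stronglyMeasurableAtFilter _ _) hf.continuousAt

lemma Iop_continuous {f : ℝ → ℝ} (hf : Continuous f) : Continuous (Iop f) :=
  continuous_iff_continuousAt.2 fun x => (Iop_hasDerivAt hf x).continuousAt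

lemma Iop_bound {f : ℝ → ℝ} (L A : ℝ) (n : ℕ)
    (h : ∀ x ∈ Icc (0:ℝ) L, |f x| ≤ A * (x ^ n / (n.factorial : ℝ))) :
    ∀ x ∈ Icc (0:ℝ) L, |Iop f x| ≤ A * (x ^ (n + 1) / ((n + 1).factorial : ℝ)) := by
  intro x hx
  have h1 : ‖∫ s in (0:ℝ)..x, f s‖ ≤ ∫ s in (0:ℝ)..x, A * (s ^ n / (n.factorial : ℝ)) := by
    apply intervalIntegral.norm_integral_le_of_norm_le hx.1
    · refine Filter.Eventually.of_forall fun t ht => ?_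
      exact h t ⟨ht.1.le, ht.2.trans hx.2⟩
    · apply Continuous.intervalIntegrable
      fun_prop
  have h2 : (∫ s in (0:ℝ)..x, A * (s ^ n / (n.factorial : ℝ)))
      = A * (x ^ (n + 1) / ((n + 1).factorial : ℝ)) := by
    rw [intervalIntegral.integral_const_mul, intervalIntegral.integral_div, integral_pow]
    have : (n.factorial : ℝ) ≠ 0 := by positivity
    rw [Nat.factorial_succ]
    push_cast
    field_simp
    simp
  rw [h2] at h1
  exact h1

lemma Iop_congr {f g : ℝ → ℝ} {L : ℝ} (h : ∀ x ∈ Icc (0:ℝ) L, f x = g x) :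
    ∀ x ∈ Icc (0:ℝ) L, Iop f x = Iop g x := by
  intro x hx
  apply intervalIntegral.integral_congr
  intro s hs
  rw [uIcc_of_le hx.1] at hs
  exact h s ⟨hs.1, hs.2.trans hx.2⟩

lemma V_eq {w EI U E : ℝ → ℝ} {L : ℝ} (hw : ∀ x ∈ Icc (0:ℝ) L, w x = U x)
    (he : ∀ x ∈ Icc (0:ℝ) L, (EI x)⁻¹ = E x) :
    ∀ x ∈ Icc (0:ℝ) L,
      (∫ s₁ in (0:ℝ)..x, ∫ s₂ in (0:ℝ)..s₁, ∫ s₃ in (0:ℝ)..s₂, ∫ s₄ in (0:ℝ)..s₃,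
          w s₄ / EI s₂) = Iop (Iop (fun s => Iop (Iop U) s * E s)) x := by
  refine Iop_congr (Iop_congr ?_)
  intro s₂ hs₂
  have h1 := Iop_congr (Iop_congr hw) s₂ hs₂
  rw [← h1, ← he s₂ hs₂]
  simp only [Iop, div_eq_mul_inv, intervalIntegral.integral_mul_const]

lemma exists_ext {f : ℝ → ℝ} {L : ℝ} (hL : 0 ≤ L) (hf : ContinuousOn f (Icc 0 L)) :
    ∃ F : ℝ → ℝ, Continuous F ∧ ∀ x ∈ Icc (0:ℝ) L, f x = F x := by
  refine ⟨IccExtend hL ((Icc 0 L).domRestrict f), ?_, ?_⟩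
  · exact (continuousOn_iff_continuous_domRestrict.1 hf).Icc_extend'
  · intro x hx
    rw [IccExtend_of_mem hL _ hx]
    rfl

lemma V_cont {w EI : ℝ → ℝ} {L : ℝ} (hL : 0 ≤ L) (hw : ContinuousOn w (Icc 0 L))
    (he : ContinuousOn (fun x => (EI x)⁻¹) (Icc 0 L)) :
    ContinuousOn (fun x => ∫ s₁ in (0:ℝ)..x, ∫ s₂ in (0:ℝ)..s₁, ∫ s₃ in (0:ℝ)..s₂,
      ∫ s₄ in (0:ℝ)..s₃, w s₄ / EI s₂) (Icc 0 L) := by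
  obtain ⟨U, hU, hwU⟩ := exists_ext hL hw
  obtain ⟨E, hE, heE⟩ := exists_ext hL he
  refine ContinuousOn.congr ?_ (V_eq hwU heE)
  exact (Iop_continuous (Iop_continuous
    ((Iop_continuous (Iop_continuous hU)).mul hE))).continuousOn

lemma V_bound {w EI : ℝ → ℝ} {L A K : ℝ} (n : ℕ) (hL : 0 < L) (hK : 0 ≤ K)
    (hw : ContinuousOn w (Icc 0 L))
    (he : ContinuousOn (fun x => (EI x)⁻¹) (Icc 0 L))
    (heK : ∀ x ∈ Icc (0:ℝ) L, |(EI x)⁻¹| ≤ K)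
    (hwA : ∀ x ∈ Icc (0:ℝ) L, |w x| ≤ A * (x ^ n / (n.factorial : ℝ)))
    {F : ℝ → ℝ} (hF : F = fun x => -∫ s₁ in (0:ℝ)..x, ∫ s₂ in (0:ℝ)..s₁, ∫ s₃ in (0:ℝ)..s₂,
      ∫ s₄ in (0:ℝ)..s₃, w s₄ / EI s₂) :
    (∀ x ∈ Icc (0:ℝ) L, |F x| ≤ A * K * (x ^ (n + 4) / ((n + 4).factorial : ℝ))) ∧
    |derivWithin F (Icc 0 L) L| ≤ A * K * (L ^ (n + 3) / ((n + 3).factorial : ℝ)) := by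
  obtain ⟨U, hU, hwU⟩ := exists_ext hL.le hw
  obtain ⟨E, hE, heE⟩ := exists_ext hL.le he
  have hFeq : ∀ x ∈ Icc (0:ℝ) L, F x = -Iop (Iop (fun s => Iop (Iop U) s * E s)) x := by
    intro x hx
    rw [hF, ← V_eq hwU heE x hx]
  have hUA : ∀ x ∈ Icc (0:ℝ) L, |U x| ≤ A * (x ^ n / (n.factorial : ℝ)) := by
    intro x hx
    rw [← hwU x hx]
    exact hwA x hx
  have h2 := Iop_bound L A _ (Iop_bound L A n hUA)
  have h3 : ∀ x ∈ Icc (0:ℝ) L, |Iop (Iop U) x * E x|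
      ≤ A * K * (x ^ (n + 1 + 1) / ((n + 1 + 1).factorial : ℝ)) := by
    intro x hx
    rw [abs_mul, ← heE x hx]
    calc _ ≤ (A * (x ^ (n + 1 + 1) / ((n + 1 + 1).factorial : ℝ))) * K :=
          mul_le_mul (h2 x hx) (heK x hx) (abs_nonneg _) ((abs_nonneg _).trans (h2 x hx))
      _ = _ := by ring
  have h4 := Iop_bound L (A * K) _ h3
  have h5 := Iop_bound L (A * K) _ h4
  have hLm : L ∈ Icc (0:ℝ) L := ⟨hL.le, le_rfl⟩
  constructor
  · intro x hx
    rw [hFeq x hx, abs_neg]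
    exact h5 x hx
  · have hd : HasDerivWithinAt F (-Iop (fun s => Iop (Iop U) s * E s) L) (Icc 0 L) L := by
      refine HasDerivWithinAt.congr ?_ hFeq (hFeq L hLm)
      exact (Iop_hasDerivAt (Iop_continuous
        ((Iop_continuous (Iop_continuous hU)).mul hE)) L).neg.hasDerivWithinAt
    rw [hd.derivWithin (uniqueDiffOn_Icc hL L hLm), abs_neg]
    exact h4 L hLm

lemma fact_add_le (a b : ℕ) : ((a + b).factorial : ℝ) ≤ 2 ^ (a + b) * (a.factorial * b.factorial) := by
  have h := Nat.add_choose_mul_factorial_mul_factorial a b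
  have h2 := Nat.choose_le_two_pow (a + b) b
  have h3 : (a + b).factorial ≤ 2 ^ (a + b) * (a.factorial * b.factorial) := by
    rw [← h, mul_assoc]
    exact Nat.mul_le_mul_right _ h2
  exact_mod_cast h3

lemma fact_bound (k : ℕ) : 1 / ((4 * k + 3).factorial : ℝ)
    ≤ (2 ^ 8 * 120) * 16 ^ k / ((2 * (k + 2)).factorial : ℝ) ^ 2 := by
  have h1 : ((2 * (k + 2)).factorial : ℝ) ^ 2 ≤ ((4 * k + 3 + 5).factorial : ℝ) := by
    have := Nat.factorial_mul_factorial_dvd_factorial_add (2 * (k + 2)) (2 * (k + 2))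
    have := Nat.le_of_dvd (Nat.factorial_pos _) this
    rw [show 2 * (k + 2) + 2 * (k + 2) = 4 * k + 3 + 5 by ring] at this
    rw [sq]
    exact_mod_cast this
  have h2 := fact_add_le (4 * k + 3) 5
  rw [div_le_div_iff₀ (by positivity) (by positivity)]
  have h3 : (2:ℝ) ^ (4 * k + 3 + 5) = 2 ^ 8 * 16 ^ k := by
    rw [show 4 * k + 3 + 5 = 8 + 4 * k by ring, pow_add, pow_mul]; norm_num
  have h4 : ((Nat.factorial 5 : ℕ) : ℝ) = 120 := by norm_num [Nat.factorial]
  rw [h3, h4] at h2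
  nlinarith

lemma coef_bound {L : ℝ} (hL : 0 < L) {ρ EI : ℝ → ℝ} (hρ : ContinuousOn ρ (Icc 0 L))
    (he : ContinuousOn (fun x => (EI x)⁻¹) (Icc 0 L)) (f : ℕ → ℝ → ℝ)
    (hf1 : ContinuousOn (f 1) (Icc 0 L))
    (hf : ∀ k, f (k + 2) = fun x => -∫ s₁ in (0:ℝ)..x, ∫ s₂ in (0:ℝ)..s₁, ∫ s₃ in (0:ℝ)..s₂,
      ∫ s₄ in (0:ℝ)..s₃, ρ s₄ * f (k + 1) s₄ / EI s₂) :
    ∃ M C : ℝ, 0 < M ∧ 0 < C ∧ ∀ k,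
      |derivWithin (f k) (Icc 0 L) L| ≤ M * C ^ k / ((2 * k).factorial : ℝ) ^ 2 := by
  obtain ⟨R, hR⟩ := isCompact_Icc.exists_bound_of_continuousOn hρ
  obtain ⟨K, hK⟩ := isCompact_Icc.exists_bound_of_continuousOn he
  obtain ⟨A, hA⟩ := isCompact_Icc.exists_bound_of_continuousOn hf1
  have h0 : (0:ℝ) ∈ Icc (0:ℝ) L := ⟨le_rfl, hL.le⟩
  have hR0 : 0 ≤ R := (norm_nonneg _).trans (hR 0 h0)
  have hK0 : 0 ≤ K := (norm_nonneg _).trans (hK 0 h0)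
  have hA0 : 0 ≤ A := (norm_nonneg _).trans (hA 0 h0)
  have hcont : ∀ k, ContinuousOn (f (k + 1)) (Icc 0 L) := by
    intro k
    induction k with
    | zero => exact hf1
    | succ k ih =>
      rw [hf k]
      exact (V_cont (w := fun s => ρ s * f (k + 1) s) hL.le (hρ.mul ih) he).neg
  have key : ∀ k (B : ℝ), (∀ x ∈ Icc (0:ℝ) L, |f (k + 1) x| ≤ B * (x ^ (4 * k) / ((4 * k).factorial : ℝ))) →
      (∀ x ∈ Icc (0:ℝ) L, |f (k + 2) x| ≤ R * B * K * (x ^ (4 * k + 4) / ((4 * k + 4).factorial : ℝ))) ∧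
      |derivWithin (f (k + 2)) (Icc 0 L) L|
        ≤ R * B * K * (L ^ (4 * k + 3) / ((4 * k + 3).factorial : ℝ)) := by
    intro k B hB
    refine V_bound (w := fun s => ρ s * f (k + 1) s) (4 * k) hL hK0 (hρ.mul (hcont k)) he hK ?_ (hf k)
    intro x hx
    rw [abs_mul, mul_assoc]
    exact mul_le_mul (hR x hx) (hB x hx) (abs_nonneg _) hR0
  have hb : ∀ k, ∀ x ∈ Icc (0:ℝ) L, |f (k + 1) x|
      ≤ (A * (R * K) ^ k) * (x ^ (4 * k) / ((4 * k).factorial : ℝ)) := by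
    intro k
    induction k with
    | zero => intro x hx; simpa using hA x hx
    | succ k ih =>
      intro x hx
      refine ((key k _ ih).1 x hx).trans (le_of_eq ?_)
      rw [show 4 * (k + 1) = 4 * k + 4 by ring]
      ring
  set Q : ℝ := R * K * L ^ 4 * 16 with hQ
  have hQ0 : 0 ≤ Q := by positivity
  set d0 := |derivWithin (f 0) (Icc 0 L) L| with hd0
  set d1 := |derivWithin (f 1) (Icc 0 L) L| with hd1
  have hd0' : 0 ≤ d0 := abs_nonneg _
  have hd1' : 0 ≤ d1 := abs_nonneg _
  set N : ℝ := A * (R * K) * L ^ 3 * (2 ^ 8 * 120) with hN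
  have hN0 : 0 ≤ N := by positivity
  refine ⟨1 + d0 + 4 * d1 + N, 1 + Q, by positivity, by positivity, ?_⟩
  intro k
  match k with
  | 0 =>
    simp
    linarith
  | 1 =>
    rw [le_div_iff₀ (by positivity)]
    norm_num [Nat.factorial]
    nlinarith [mul_nonneg hQ0 hd0', mul_nonneg hQ0 hd1', mul_nonneg hQ0 hN0]
  | (k + 2) =>
    have h1 := (key k _ (hb k)).2
    have h2 := fact_bound k
    have h3 : R * (A * (R * K) ^ k) * K * (L ^ (4 * k + 3) / ((4 * k + 3).factorial : ℝ))
        = (A * (R * K) * L ^ 3) * (R * K * L ^ 4) ^ k * (1 / ((4 * k + 3).factorial : ℝ)) := by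
      rw [pow_add, pow_mul, mul_pow (R * K) (L ^ 4)]
      ring
    rw [h3] at h1
    have h4 : (A * (R * K) * L ^ 3) * (R * K * L ^ 4) ^ k * (1 / ((4 * k + 3).factorial : ℝ))
        ≤ (A * (R * K) * L ^ 3) * (R * K * L ^ 4) ^ k *
          ((2 ^ 8 * 120) * 16 ^ k / ((2 * (k + 2)).factorial : ℝ) ^ 2) :=
      mul_le_mul_of_nonneg_left h2 (by positivity)
    refine h1.trans (h4.trans ?_)
    have h5 : (A * (R * K) * L ^ 3) * (R * K * L ^ 4) ^ k *
          ((2 ^ 8 * 120) * 16 ^ k / ((2 * (k + 2)).factorial : ℝ) ^ 2)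
        = N * Q ^ k / ((2 * (k + 2)).factorial : ℝ) ^ 2 := by
      rw [hN, hQ, mul_pow (R * K * L ^ 4)]
      ring
    rw [h5]
    apply div_le_div_of_nonneg_right _ (by positivity)
    apply mul_le_mul (by linarith) _ (by positivity) (by positivity)
    calc Q ^ k ≤ (1 + Q) ^ k := pow_le_pow_left₀ hQ0 (by linarith) _
      _ ≤ (1 + Q) ^ (k + 2) := pow_le_pow_right₀ (by linarith) (by omega)

lemma superexp (D ε : ℝ) (hD : 0 < D) (hε : 0 < ε) :
    ∃ K : ℝ, 0 ≤ K ∧ ∀ n : ℕ, D ^ n * ((2 * n).factorial : ℝ) ^ (-ε) ≤ K * (1 / 2) ^ n := by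
  set c : ℝ := (2 * D) ^ (1 / ε) with hc
  have hc0 : 0 < c := by positivity
  have ht := FloorSemiring.tendsto_pow_div_factorial_atTop c
  obtain ⟨K, hK⟩ := ht.bddAbove_range
  have hK' : ∀ n : ℕ, c ^ n / (n.factorial : ℝ) ≤ K := fun n => hK ⟨n, rfl⟩
  have hK0 : 0 ≤ K := le_trans (by positivity) (hK' 0)
  refine ⟨K ^ ε, by positivity, fun n => ?_⟩
  have h1 : c ^ n / ((2 * n).factorial : ℝ) ≤ K := by
    refine le_trans ?_ (hK' n)
    apply div_le_div_of_nonneg_left (by positivity) (by positivity)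
    exact_mod_cast Nat.factorial_le (by omega)
  have h2 := Real.rpow_le_rpow (by positivity) h1 hε.le
  have h3 : (c ^ n) ^ ε = (2 * D) ^ n := by
    rw [hc, ← Real.rpow_natCast, ← Real.rpow_mul (by positivity), ← Real.rpow_mul (by positivity),
      ← Real.rpow_natCast]
    congr 1
    field_simp
  rw [Real.div_rpow (by positivity) (by positivity), h3, mul_pow] at h2
  rw [Real.rpow_neg (by positivity)]
  have h4 : (2:ℝ) ^ n * (1 / 2) ^ n = 1 := by rw [← mul_pow]; norm_num
  calc D ^ n * (((2 * n).factorial : ℝ) ^ ε)⁻¹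
      = (2 ^ n * (1 / 2) ^ n) * (D ^ n * (((2 * n).factorial : ℝ) ^ ε)⁻¹) := by rw [h4, one_mul]
    _ = (2 ^ n * D ^ n / ((2 * n).factorial : ℝ) ^ ε) * (1 / 2) ^ n := by
        rw [div_eq_mul_inv]; ring
    _ ≤ _ := mul_le_mul_of_nonneg_right h2 (by positivity)

lemma term_bound {M C D s T : ℝ} (hM : 0 < M) (hC : 0 < C) (hD : 0 < D) (hs1 : 1 < s) (hs2 : s < 2)
    {p : ℝ → ℝ} (hp : ∀ (n : ℕ), ∀ t ∈ Set.Icc (0:ℝ) T,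
      |iteratedDeriv n p t| ≤ D ^ (n + 1) * (n.factorial : ℝ) ^ s)
    {b : ℕ → ℝ} (hb : ∀ k, |b k| ≤ M * C ^ k / ((2 * k).factorial : ℝ) ^ 2) (m : ℕ) :
    ∃ K : ℝ, ∀ k, ∀ t ∈ Set.Icc (0:ℝ) T,
      |b k * iteratedDeriv (2 * k + m) p t| ≤ K * (1 / 2) ^ k := by
  obtain ⟨K, hK0, hK⟩ := superexp (16 * C * D ^ 2) (2 - s) (by positivity) (by linarith)
  refine ⟨M * D ^ (m + 1) * 4 ^ m * (m.factorial : ℝ) ^ 2 * K, fun k t ht => ?_⟩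
  set F : ℝ := ((2 * k).factorial : ℝ) with hF
  have hF0 : 0 < F := by positivity
  have hm1 : (1:ℝ) ≤ m.factorial := by exact_mod_cast Nat.factorial_pos m
  have h1 : ((2 * k + m).factorial : ℝ) ^ s ≤ (2 ^ (2 * k + m) * (m.factorial : ℝ)) ^ 2 * F ^ s := by
    calc ((2 * k + m).factorial : ℝ) ^ s
        ≤ ((2 ^ (2 * k + m) * (m.factorial : ℝ)) * F) ^ s := by
          apply Real.rpow_le_rpow (by positivity) _ (by linarith)
          refine (fact_add_le (2 * k) m).trans (le_of_eq ?_)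
          ring
      _ = (2 ^ (2 * k + m) * (m.factorial : ℝ)) ^ s * F ^ s :=
          Real.mul_rpow (by positivity) (by positivity)
      _ ≤ _ := by
          apply mul_le_mul_of_nonneg_right _ (by positivity)
          rw [← Real.rpow_natCast (2 ^ (2 * k + m) * (m.factorial : ℝ)) 2]
          apply Real.rpow_le_rpow_of_exponent_le
          · have : (1:ℝ) ≤ 2 ^ (2 * k + m) := one_le_pow₀ (by norm_num)
            nlinarith
          · push_cast; linarith
  have h2 : F ^ s / F ^ 2 = F ^ (-(2 - s)) := by
    rw [← Real.rpow_natCast F 2, ← Real.rpow_sub hF0]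
    congr 1
    push_cast; ring
  rw [abs_mul]
  calc |b k| * |iteratedDeriv (2 * k + m) p t|
      ≤ (M * C ^ k / F ^ 2) * (D ^ (2 * k + m + 1) * ((2 ^ (2 * k + m) * (m.factorial : ℝ)) ^ 2 * F ^ s)) := by
        apply mul_le_mul (hb k) _ (abs_nonneg _) (by positivity)
        exact (hp _ t ht).trans (mul_le_mul_of_nonneg_left h1 (by positivity))
    _ = M * D ^ (m + 1) * 4 ^ m * (m.factorial : ℝ) ^ 2 * ((16 * C * D ^ 2) ^ k * (F ^ s / F ^ 2)) := by
        have e1 : ((2:ℝ) ^ (2 * k + m)) ^ 2 = 16 ^ k * 4 ^ m := by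
          rw [← pow_mul, show (2 * k + m) * 2 = 4 * k + 2 * m by ring, pow_add, pow_mul, pow_mul]
          norm_num
        have e2 : D ^ (2 * k + m + 1) = (D ^ 2) ^ k * D ^ (m + 1) := by
          rw [add_assoc, pow_add, pow_mul]
        rw [mul_pow (2 ^ (2 * k + m)), e1, e2, mul_pow, mul_pow]
        ring
    _ ≤ M * D ^ (m + 1) * 4 ^ m * (m.factorial : ℝ) ^ 2 * (K * (1 / 2) ^ k) := by
        rw [h2]
        exact mul_le_mul_of_nonneg_left (hK k) (by positivity)
    _ = _ := by ring

lemma pair_bound {M C D s T : ℝ} (hM : 0 < M) (hC : 0 < C) (hD : 0 < D) (hs2 : s < 2)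
    {p : ℝ → ℝ} (hp : ∀ (n : ℕ), ∀ t ∈ Set.Icc (0:ℝ) T,
      |iteratedDeriv n p t| ≤ D ^ (n + 1) * (n.factorial : ℝ) ^ s)
    {a b : ℕ → ℝ} (ha : ∀ k, |a k| ≤ M * C ^ k / ((2 * k).factorial : ℝ) ^ 2)
    (hb : ∀ k, |b k| ≤ M * C ^ k / ((2 * k).factorial : ℝ) ^ 2) :
    ∃ K : ℝ, ∀ j k, ∀ t ∈ Set.Icc (0:ℝ) T,
      |a j * (b k * iteratedDeriv (2 * k + 2 * j) p t)| ≤ K * ((1 / 2) ^ j * (1 / 2) ^ k) := by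
  obtain ⟨K, hK0, hK⟩ := superexp (16 * C * D ^ 2) (2 - s) (by positivity) (by linarith)
  refine ⟨M ^ 2 * D * K, fun j k t ht => ?_⟩
  set F : ℝ := ((2 * (k + j)).factorial : ℝ) with hF
  have hF0 : 0 < F := by positivity
  set G : ℝ := ((2 * j).factorial : ℝ) with hG
  set H : ℝ := ((2 * k).factorial : ℝ) with hH
  have hG0 : 0 < G := by positivity
  have hH0 : 0 < H := by positivity
  have h2 : F ^ s / F ^ 2 = F ^ (-(2 - s)) := by
    rw [← Real.rpow_natCast F 2, ← Real.rpow_sub hF0]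
    congr 1
    push_cast; ring
  have h1 : F ≤ 4 ^ (k + j) * (H * G) := by
    have := fact_add_le (2 * k) (2 * j)
    rw [← mul_add, pow_mul] at this
    norm_num at this
    exact this
  have h3 : 1 / (G ^ 2 * H ^ 2) ≤ 16 ^ (k + j) / F ^ 2 := by
    rw [div_le_div_iff₀ (by positivity) (by positivity), one_mul]
    calc F ^ 2 ≤ (4 ^ (k + j) * (H * G)) ^ 2 := pow_le_pow_left₀ hF0.le h1 2
      _ = _ := by
        rw [mul_pow, ← pow_mul, mul_comm (k + j) 2, pow_mul]
        norm_num
        ring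
  have hpt := hp (2 * k + 2 * j) t ht
  rw [← mul_add, ← hF] at hpt
  rw [abs_mul, abs_mul, ← mul_add]
  calc |a j| * (|b k| * |iteratedDeriv (2 * (k + j)) p t|)
      ≤ (M * C ^ j / G ^ 2) * ((M * C ^ k / H ^ 2) * (D ^ (2 * (k + j) + 1) * F ^ s)) := by
        apply mul_le_mul (ha j) _ (by positivity) (by positivity)
        exact mul_le_mul (hb k) hpt (abs_nonneg _) (by positivity)
    _ = M ^ 2 * C ^ (k + j) * (D ^ (2 * (k + j) + 1) * F ^ s) * (1 / (G ^ 2 * H ^ 2)) := by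
        field_simp
        ring
    _ ≤ M ^ 2 * C ^ (k + j) * (D ^ (2 * (k + j) + 1) * F ^ s) * (16 ^ (k + j) / F ^ 2) :=
        mul_le_mul_of_nonneg_left h3 (by positivity)
    _ = M ^ 2 * D * ((16 * C * D ^ 2) ^ (k + j) * (F ^ s / F ^ 2)) := by
        rw [mul_pow, mul_pow, pow_succ D, pow_mul]
        ring
    _ ≤ M ^ 2 * D * (K * (1 / 2) ^ (k + j)) := by
        rw [h2]
        exact mul_le_mul_of_nonneg_left (hK _) (by positivity)
    _ = _ := by rw [pow_add]; ring

lemma hasDerivWithinAt_tsum_Icc {T : ℝ} (hT : 0 < T) {f f' : ℕ → ℝ → ℝ} {u v : ℕ → ℝ}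
    (hf : ∀ k x, HasDerivAt (f k) (f' k x) x) (hf' : ∀ k, Continuous (f' k))
    (hu : Summable u) (hv : Summable v)
    (hfu : ∀ k, ∀ t ∈ Icc (0:ℝ) T, |f k t| ≤ u k)
    (hfv : ∀ k, ∀ t ∈ Icc (0:ℝ) T, |f' k t| ≤ v k) :
    ∀ t ∈ Icc (0:ℝ) T,
      HasDerivWithinAt (fun x => ∑' k, f k x) (∑' k, f' k t) (Icc 0 T) t := by
  set P : ℝ → ℝ := fun x => (projIcc 0 T hT.le x : ℝ) with hP
  have hPc : Continuous P := continuous_subtype_val.comp continuous_projIcc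
  have hPm : ∀ x, P x ∈ Icc (0:ℝ) T := fun x => (projIcc 0 T hT.le x).2
  have hPe : ∀ x ∈ Icc (0:ℝ) T, P x = x := fun x hx => by
    simp only [hP, projIcc_of_mem hT.le hx]
  set G : ℝ → ℝ := fun x => ∑' k, f' k (P x) with hG
  have hGc : Continuous G :=
    continuous_tsum (fun k => (hf' k).comp hPc) hv (fun k x => hfv k _ (hPm x))
  have h0 : (0:ℝ) ∈ Icc (0:ℝ) T := ⟨le_rfl, hT.le⟩
  have hsum : ∀ t ∈ Icc (0:ℝ) T, Summable fun k => f k t := fun t ht =>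
    Summable.of_norm_bounded hu (fun k => hfu k t ht)
  have key : ∀ x ∈ Icc (0:ℝ) T, (∑' k, f k x) = (∑' k, f k 0) + Iop G x := by
    intro x hx
    have h1 : HasSum (fun k => ∫ t in (0:ℝ)..x, f' k (P t)) (∫ t in (0:ℝ)..x, G t) := by
      apply intervalIntegral.hasSum_integral_of_dominated_convergence (fun k _ => v k)
      · intro k
        exact ((hf' k).comp hPc).aestronglyMeasurable
      · intro k
        exact Filter.Eventually.of_forall fun t _ => hfv k _ (hPm t)
      · exact Filter.Eventually.of_forall fun t _ => hv
      · exact intervalIntegrable_const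
      · refine Filter.Eventually.of_forall fun t _ => ?_
        exact (Summable.of_norm_bounded hv (fun k => hfv k _ (hPm t))).hasSum
    have h2 : ∀ k, (∫ t in (0:ℝ)..x, f' k (P t)) = f k x - f k 0 := by
      intro k
      rw [← intervalIntegral.integral_eq_sub_of_hasDerivAt (fun t _ => hf k t)
        ((hf' k).intervalIntegrable _ _)]
      apply intervalIntegral.integral_congr
      intro t ht
      rw [uIcc_of_le hx.1] at ht
      simp only [hPe t ⟨ht.1, ht.2.trans hx.2⟩]
    have h3 : HasSum (fun k => f k x - f k 0) ((∑' k, f k x) - ∑' k, f k 0) :=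
      (hsum x hx).hasSum.sub (hsum 0 h0).hasSum
    simp only [h2] at h1
    have h4 := h3.unique h1
    simp only [Iop]
    linarith
  intro t ht
  have hd : HasDerivWithinAt (fun x => (∑' k, f k 0) + Iop G x) (G t) (Icc 0 T) t :=
    ((Iop_hasDerivAt hGc t).const_add _).hasDerivWithinAt
  have hGt : G t = ∑' k, f' k t := by simp only [hG, hPe t ht]
  rw [← hGt]
  exact hd.congr key (key t ht)

lemma iterDeriv_series {T : ℝ} (hT : 0 < T) {p : ℝ → ℝ} (hp : ContDiff ℝ (⊤ : ℕ∞) p) {b : ℕ → ℝ}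
    (hb : ∀ m : ℕ, ∃ K : ℝ, ∀ k, ∀ t ∈ Set.Icc (0:ℝ) T,
      |b k * iteratedDeriv (2 * k + m) p t| ≤ K * (1 / 2) ^ k) (n : ℕ) :
    ∀ t ∈ Icc (0:ℝ) T,
      iteratedDerivWithin n (fun t => ∑' k : ℕ, b k * iteratedDeriv (2 * k) p t) (Icc 0 T) t
        = ∑' k : ℕ, b k * iteratedDeriv (2 * k + n) p t := by
  induction n with
  | zero => intro t ht; simp
  | succ n ih =>
    intro t ht
    rw [iteratedDerivWithin_succ, derivWithin_congr ih (ih t ht)]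
    obtain ⟨K, hK⟩ := hb n
    obtain ⟨K', hK'⟩ := hb (n + 1)
    have hg : Summable fun k : ℕ => ((1:ℝ) / 2) ^ k := summable_geometric_two
    refine HasDerivWithinAt.derivWithin ?_ (uniqueDiffOn_Icc hT t ht)
    refine hasDerivWithinAt_tsum_Icc hT (f := fun k t => b k * iteratedDeriv (2 * k + n) p t)
      (f' := fun k t => b k * iteratedDeriv (2 * k + (n + 1)) p t)
      ?_ ?_ (hg.mul_left K) (hg.mul_left K') hK hK' t ht
    · intro k x
      apply HasDerivAt.const_mul
      rw [← add_assoc, iteratedDeriv_succ]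
      apply DifferentiableAt.hasDerivAt
      exact (hp.differentiable_iteratedDeriv (2 * k + n)
        (WithTop.coe_lt_coe.2 (ENat.coe_lt_top _))) x
    · intro k
      exact continuous_const.mul (hp.continuous_iteratedDeriv _ (WithTop.coe_le_coe.2 le_top))

lemma main {T s M C : ℝ} (hT : 0 < T) (hs₁ : 1 < s) (hs₂ : s < 2) (hM : 0 < M) (hC : 0 < C)
    {p : ℝ → ℝ} (hp : MemGevrey s T p) {a b : ℕ → ℝ}
    (ha : ∀ k, |a k| ≤ M * C ^ k / ((2 * k).factorial : ℝ) ^ 2)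
    (hb : ∀ k, |b k| ≤ M * C ^ k / ((2 * k).factorial : ℝ) ^ 2) :
    ∀ t ∈ Icc (0:ℝ) T,
      (∑' k : ℕ, a k * iteratedDerivWithin (2 * k)
        (fun t => ∑' k : ℕ, b k * iteratedDeriv (2 * k) p t) (Icc 0 T) t) +
      (∑' k : ℕ, b k * iteratedDerivWithin (2 * k)
        (fun t => -∑' k : ℕ, a k * iteratedDeriv (2 * k) p t) (Icc 0 T) t) = 0 := by
  obtain ⟨hpc, D, hD, hpD⟩ := hp
  intro t ht
  have e1 : ∀ n, _ := fun n => iterDeriv_series hT hpc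
    (term_bound hM hC hD hs₁ hs₂ hpD hb) n t ht
  have e2 : ∀ n, _ := fun n => iterDeriv_series hT hpc (b := fun k => -a k)
    (term_bound hM hC hD hs₁ hs₂ hpD (b := fun k => -a k) (fun k => by simpa using ha k)) n t ht
  simp only [neg_mul, tsum_neg] at e2
  simp only [e1, e2, mul_neg, tsum_neg]
  obtain ⟨K, hK⟩ := pair_bound hM hC hD hs₂ hpD ha hb
  have hg : Summable fun k : ℕ => ((1:ℝ) / 2) ^ k := summable_geometric_two
  have hS : Summable (Function.uncurry fun j k : ℕ =>
      a j * (b k * iteratedDeriv (2 * k + 2 * j) p t)) := by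
    refine Summable.of_norm_bounded (g := fun x : ℕ × ℕ => K * ((1 / 2) ^ x.1 * (1 / 2) ^ x.2)) ?_ ?_
    · exact (hg.mul_of_nonneg hg (fun _ => by positivity) (fun _ => by positivity)).mul_left K
    · rintro ⟨j, k⟩
      exact hK j k t ht
  have h := hS.tsum_comm
  simp only [← tsum_mul_left]
  rw [← h, ← sub_eq_add_neg, sub_eq_zero]
  refine tsum_congr fun j => tsum_congr fun k => ?_
  rw [add_comm (2 * k)]
  ring

end Beam

/-- with `y₁ = L₂ p` and `y₂ = -L₁ p`, the flat outputs satisfy the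
infinite-order differential equation
`Σ_k g_k'(L) y₁⁽²ᵏ⁾(t) + Σ_k h_k'(L) y₂⁽²ᵏ⁾(t) = 0` for all `t ∈ [0,T]`. -/
theorem stmt14 (L m J : ℝ) (hL : 0 < L) (hm : 0 < m) (hJ : 0 < J)
    (ρ EI : ℝ → ℝ)
    (hρ : ContDiffOn ℝ 4 ρ (Set.Icc 0 L)) (hEI : ContDiffOn ℝ 4 EI (Set.Icc 0 L))
    (hρpos : ∃ c > 0, ∀ x ∈ Set.Icc (0:ℝ) L, c ≤ ρ x)
    (hEIpos : ∃ c > 0, ∀ x ∈ Set.Icc (0:ℝ) L, c ≤ EI x)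
    (T s : ℝ) (hT : 0 < T) (hs₁ : 1 < s) (hs₂ : s < 2)
    (p : ℝ → ℝ) (hp : MemGevrey s T p)
    (y₁ y₂ : ℝ → ℝ)
    (hy₁ : y₁ = fun t =>
      ∑' k : ℕ, derivWithin (genH ρ EI J k) (Set.Icc 0 L) L * iteratedDeriv (2 * k) p t)
    (hy₂ : y₂ = fun t =>
      -∑' k : ℕ, derivWithin (genG ρ EI m k) (Set.Icc 0 L) L * iteratedDeriv (2 * k) p t) :
    ∀ t ∈ Set.Icc (0:ℝ) T,
      (∑' k : ℕ, derivWithin (genG ρ EI m k) (Set.Icc 0 L) L *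
        iteratedDerivWithin (2 * k) y₁ (Set.Icc 0 T) t) +
      (∑' k : ℕ, derivWithin (genH ρ EI J k) (Set.Icc 0 L) L *
        iteratedDerivWithin (2 * k) y₂ (Set.Icc 0 T) t) = 0 := by
  have hρc := hρ.continuousOn
  have he : ContinuousOn (fun x => (EI x)⁻¹) (Icc 0 L) := by
    obtain ⟨c, hc, h⟩ := hEIpos
    exact hEI.continuousOn.inv₀ fun x hx => (hc.trans_le (h x hx)).ne'
  obtain ⟨E, hE, heE⟩ := Beam.exists_ext hL.le he
  have hG1 : ContinuousOn (genG ρ EI m 1) (Icc 0 L) := by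
    unfold genG
    refine (Beam.V_cont hL.le hρc he).neg.sub (continuousOn_const.mul ?_)
    refine ContinuousOn.congr (f := Beam.Iop (Beam.Iop (fun s => s * E s))) ?_ ?_
    · exact (Beam.Iop_continuous (Beam.Iop_continuous (continuous_id.mul hE))).continuousOn
    · refine Beam.Iop_congr (Beam.Iop_congr fun x hx => ?_)
      simp [← heE x hx]
  have hH1 : ContinuousOn (genH ρ EI J 1) (Icc 0 L) := by
    unfold genH
    refine (Beam.V_cont (w := fun s => s * ρ s) hL.le (continuousOn_id.mul hρc) he).neg.add
      (continuousOn_const.mul ?_)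
    refine ContinuousOn.congr (f := Beam.Iop (Beam.Iop E)) ?_ ?_
    · exact (Beam.Iop_continuous (Beam.Iop_continuous hE)).continuousOn
    · refine Beam.Iop_congr (Beam.Iop_congr fun x hx => ?_)
      simp [← heE x hx]
  obtain ⟨M₁, C₁, hM₁, hC₁, h₁⟩ := Beam.coef_bound hL hρc he (genG ρ EI m) hG1
    (fun k => by rw [genG])
  obtain ⟨M₂, C₂, hM₂, hC₂, h₂⟩ := Beam.coef_bound hL hρc he (genH ρ EI J) hH1
    (fun k => by rw [genH])
  subst hy₁ hy₂
  refine Beam.main (M := M₁ + M₂) (C := C₁ + C₂) hT hs₁ hs₂ (by positivity) (by positivity) hp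
    (fun k => (h₁ k).trans ?_) (fun k => (h₂ k).trans ?_)
  · gcongr <;> linarith
  · gcongr <;> linarith
end
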